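/- Let T : X → X be an open, distance expanding, topologically transitive map of a compact metric space, φ : X → ℝ continuous, and ν a φ-conformal measure with L*_φ ν = λ ν (λ > 0), so that J_ν T = λ e^{−φ} is the Jacobian of T with respect to ν. Set P = log λ. Given δ > 0, for all sufficiently small ε > 0 there exists α(ε) > 0 such that for every x ∈ X and every n ≥ 1, α(ε) e^{−nδ} ≤ ν(B(x, n, ε)) / exp(S_n φ(x) − Pn) ≤ e^{nδ}, where S_n φ(x) = Σ_{j=0}^{n-1} φ(T^j x) and B(x, n, ε) = {y : d(T^j x, T^j y) ≤ ε, 0 ≤ j ≤ n−1}. -/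

import Mathlib

open MeasureTheory Filter Set Topology
open scoped ENNReal NNReal



section MetricDefs

variable {X : Type*} [MetricSpace X] [MeasurableSpace X] [BorelSpace X]

/-- `T` is distance expanding: there are `λ > 1` and `η > 0` with
`d(x,y) < 2η → d(Tx,Ty) ≥ λ d(x,y)`. -/
def DistanceExpanding (T : X → X) : Prop :=
  ∃ lam η : ℝ, 1 < lam ∧ 0 < η ∧
    ∀ x y : X, dist x y < 2 * η → lam * dist x y ≤ dist (T x) (T y)

/-- Topological transitivity. -/
def TopTransitive (T : X → X) : Prop :=
  ∀ U V : Set X, IsOpen U → IsOpen V → U.Nonempty → V.Nonempty →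
    ∃ n : ℕ, (T^[n] '' U ∩ V).Nonempty

/-- Topological exactness. -/
def TopExact (T : X → X) : Prop :=
  ∀ U : Set X, IsOpen U → U.Nonempty → ∃ N : ℕ, T^[N] '' U = Set.univ

/-- Ruelle–Perron–Frobenius transfer operator `L_φ g (x) = ∑_{T y = x} e^{φ y} g y`. -/
noncomputable def transferOp (T : X → X) (φ : X → ℝ) (g : X → ℝ) (x : X) : ℝ :=
  ∑' y : (T ⁻¹' {x} : Set X), Real.exp (φ y) * g y

/-- `ν` is a `φ`-conformal measure with eigenvalue `lam`: `L_φ^* ν = lam • ν`. -/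
def IsConformal (T : X → X) (φ : X → ℝ) (ν : Measure X) (lam : ℝ) : Prop :=
  0 < lam ∧ ∀ g : C(X, ℝ), ∫ x, transferOp T φ (⇑g) x ∂ν = lam * ∫ x, g x ∂ν

/-- Birkhoff sum `S_n φ (x)`. -/
noncomputable def birkhoff (T : X → X) (φ : X → ℝ) (n : ℕ) (x : X) : ℝ :=
  ∑ j ∈ Finset.range n, φ (T^[j] x)

/-- The empirical probability measures `σ_n(x) = (1/n) ∑_{j<n} δ_{T^j x}` (with the
irrelevant convention `σ_0(x) = δ_x`). -/
noncomputable def empirical (T : X → X) (x : X) (n : ℕ) : ProbabilityMeasure X :=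
  if h : n = 0 then ⟨Measure.dirac x, inferInstance⟩
  else ⟨(n : ℝ≥0∞)⁻¹ • ∑ j ∈ Finset.range n, Measure.dirac (T^[j] x), by
    constructor
    rw [Measure.smul_apply, Measure.finset_sum_apply]
    simp [ENNReal.inv_mul_cancel, h]⟩

/-- `μ` is a `T`-invariant (Borel probability) measure. -/
def InvariantProb (T : X → X) (μ : ProbabilityMeasure X) : Prop :=
  (μ : Measure X).map T = (μ : Measure X)

/-- The set `pω(x)` of weak* limit points of the empirical measures of `x`. -/
def pOmega (T : X → X) (x : X) : Set (ProbabilityMeasure X) :=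
  {μ | MapClusterPt μ atTop (empirical T x)}

/-- `dP` is a metric on the space of Borel probability measures which is compatible with
the weak* topology. -/
def IsWeakStarMetric (dP : ProbabilityMeasure X → ProbabilityMeasure X → ℝ) : Prop :=
  (∀ μ ν, dP μ ν = dP ν μ) ∧ (∀ μ ν, dP μ ν = 0 ↔ μ = ν) ∧
  (∀ μ ν ρ, dP μ ρ ≤ dP μ ν + dP ν ρ) ∧
  (∀ μ : ProbabilityMeasure X, ∀ s : Set (ProbabilityMeasure X),
      s ∈ nhds μ ↔ ∃ ε > 0, {ρ | dP ρ μ < ε} ⊆ s)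

/-- The basin `A_ε(μ)` of `ε`-weak statistical attraction of `μ`. -/
noncomputable def Abasin (T : X → X) (dP : ProbabilityMeasure X → ProbabilityMeasure X → ℝ)
    (μ : ProbabilityMeasure X) (ε : ℝ) : Set X :=
  {x | sInf ((fun ρ => dP ρ μ) '' pOmega T x) < ε}

/-- The ergodic basin `B(μ) = {x : pω(x) = {μ}}`. -/
def Bbasin (T : X → X) (μ : ProbabilityMeasure X) : Set X :=
  {x | pOmega T x = {μ}}

/-- The `ε`-pseudo basin `A_{ε,n}(μ)` of `μ` up to time `n`. -/
noncomputable def Apseudo (T : X → X) (dP : ProbabilityMeasure X → ProbabilityMeasure X → ℝ)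
    (μ : ProbabilityMeasure X) (ε : ℝ) (n : ℕ) : Set X :=
  {x | dP (empirical T x n) μ < ε}

/-- `μ` is `ν`-SRB (`ν`-physical). -/
def IsSRB (T : X → X) (ν : Measure X) (μ : ProbabilityMeasure X) : Prop :=
  InvariantProb T μ ∧ 0 < ν (Bbasin T μ)

/-- `μ` is `ν`-SRB-like (`ν`-physical-like). -/
def IsSRBLike (T : X → X) (ν : Measure X) (dP : ProbabilityMeasure X → ProbabilityMeasure X → ℝ)
    (μ : ProbabilityMeasure X) : Prop :=
  InvariantProb T μ ∧ ∀ ε > 0, 0 < ν (Abasin T dP μ ε)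

/-- `μ` is `ν`-weak-SRB-like: `limsup (1/n) log ν(A_{ε,n}(μ)) = 0` for all `ε > 0`. -/
def IsWeakSRBLike (T : X → X) (ν : Measure X)
    (dP : ProbabilityMeasure X → ProbabilityMeasure X → ℝ) (μ : ProbabilityMeasure X) : Prop :=
  InvariantProb T μ ∧ ∀ ε > 0,
    Filter.limsup
      (fun n : ℕ => (((n : ℝ)⁻¹ : ℝ) : EReal) * ENNReal.log (ν (Apseudo T dP μ ε n)))
      Filter.atTop = 0

/-- The entropy of the `n`-th dynamical refinement of the finite partition `P`
with respect to `μ`. -/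
noncomputable def dynEnt (T : X → X) (μ : Measure X) {k : ℕ} (P : Fin k → Set X) (n : ℕ) : ℝ :=
  ∑ c : Fin n → Fin k, Real.negMulLog (μ (⋂ j : Fin n, T^[(j : ℕ)] ⁻¹' P (c j))).toReal

/-- Measure-theoretic (Kolmogorov–Sinai) entropy `h_μ(T)`: the supremum over finite Borel
partitions `P` of `lim_n (1/n) H(⋁_{j<n} T^{-j} P, μ)`. -/
noncomputable def metricEntropy (T : X → X) (μ : Measure X) : EReal :=
  ⨆ (k : ℕ) (P : Fin k → Set X) (_ : ∀ i, MeasurableSet (P i))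
      (_ : Pairwise (Function.onFun Disjoint P)) (_ : ⋃ i, P i = Set.univ),
    Filter.liminf (fun n : ℕ => (((n : ℝ)⁻¹ * dynEnt T μ P n : ℝ) : EReal)) Filter.atTop

/-- `E` is an `(n, ε)`-separated set. -/
def IsSeparated (T : X → X) (n : ℕ) (ε : ℝ) (E : Set X) : Prop :=
  ∀ x ∈ E, ∀ y ∈ E, x ≠ y → ∃ j < n, ε < dist (T^[j] x) (T^[j] y)

/-- `sup { ∑_{x ∈ E} e^{S_n φ(x)} : E (n,ε)-separated }`. -/
noncomputable def presSum (T : X → X) (φ : X → ℝ) (n : ℕ) (ε : ℝ) : ℝ≥0∞ :=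
  ⨆ (E : Finset X) (_ : IsSeparated T n ε ↑E), ∑ x ∈ E, ENNReal.ofReal (Real.exp (birkhoff T φ n x))

/-- Topological pressure of `φ` (via `(n,ε)`-separated sets). -/
noncomputable def topPressure (T : X → X) (φ : X → ℝ) : EReal :=
  Filter.limsup (fun ε : ℝ =>
      Filter.limsup (fun n : ℕ => (((n : ℝ)⁻¹ : ℝ) : EReal) * ENNReal.log (presSum T φ n ε))
        Filter.atTop)
    (nhdsWithin (0 : ℝ) (Set.Ioi 0))

/-- `μ` is an equilibrium state for the potential `φ`:
`h_μ(T) + ∫ φ dμ = P_top(T, φ)`. -/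
def IsEquilibrium (T : X → X) (φ : X → ℝ) (μ : ProbabilityMeasure X) : Prop :=
  InvariantProb T μ ∧
    metricEntropy T (μ : Measure X) + ((∫ x, φ x ∂(μ : Measure X) : ℝ) : EReal) = topPressure T φ

/-- `K_r(φ)`: invariant measures with `h_μ(T) + ∫φ dμ ≥ P_top(T,φ) - r`. -/
def Kset (T : X → X) (φ : X → ℝ) (r : ℝ) : Set (ProbabilityMeasure X) :=
  {μ | InvariantProb T μ ∧
    topPressure T φ - (r : EReal) ≤
      metricEntropy T (μ : Measure X) + ((∫ x, φ x ∂(μ : Measure X) : ℝ) : EReal)}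

/-- The dynamical ball `B(x, n, δ)`. -/
def dynBall (T : X → X) (x : X) (n : ℕ) (δ : ℝ) : Set X :=
  {y | ∀ j < n, dist (T^[j] x) (T^[j] y) ≤ δ}

/-- The local entropy `h_ν(T,x) = lim_{δ→0} limsup_n -(1/n) log ν(B(x,n,δ))`. -/
noncomputable def localEntropy (T : X → X) (ν : Measure X) (x : X) : EReal :=
  Filter.limsup (fun δ : ℝ =>
      Filter.limsup
        (fun n : ℕ => (((n : ℝ)⁻¹ : ℝ) : EReal) * (- ENNReal.log (ν (dynBall T x n δ))))
        Filter.atTop)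
    (nhdsWithin (0 : ℝ) (Set.Ioi 0))

/-- `h_ν(T,μ)`: the `μ`-essential supremum of `x ↦ h_ν(T,x)`. -/
noncomputable def localEntropySup (T : X → X) (ν : Measure X) (μ : Measure X) : EReal :=
  essSup (localEntropy T ν) μ

/-- `c` is an ergodic decomposition of the `T`-invariant measure `μ`. -/
def IsErgodicDecomp (T : X → X) (μ : ProbabilityMeasure X) (c : X → ProbabilityMeasure X) : Prop :=
  Measurable (fun x => (c x : Measure X)) ∧
  (∀ᵐ x ∂(μ : Measure X), Ergodic T ((c x) : Measure X)) ∧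
  (∀ A : Set X, MeasurableSet A → (μ : Measure X) A = ∫⁻ x, (c x : Measure X) A ∂(μ : Measure X))

/-- A probability measure is atomic if it is supported on a finite set. -/
def IsAtomicMeasure (μ : ProbabilityMeasure X) : Prop :=
  ∃ S : Set X, S.Finite ∧ (μ : Measure X) S = 1

end MetricDefs

theorem IsOpenMap.iterate_self {X : Type*} [TopologicalSpace X] {T : X → X} (hT : IsOpenMap T)
    (n : ℕ) : IsOpenMap T^[n] := by
  induction n with
  | zero => exact IsOpenMap.id
  | succ n ih => exact ih.comp hT

theorem birkhoff_succ {X : Type*} (T : X → X) (φ : X → ℝ) (n : ℕ) (x : X) :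
    birkhoff T φ (n + 1) x = φ x + birkhoff T φ n (T x) := by
  simp [birkhoff, Finset.sum_range_succ', add_comm]

theorem transferOp_exp_neg_mul_apply {X : Type*} {T : X → X} {φ h : X → ℝ} {U : Set X}
    (hinj : InjOn T U) (hh : ∀ y ∉ U, h y = 0) {y : X} (hy : y ∈ U) :
    transferOp T φ (fun z => Real.exp (-φ z) * h z) (T y) = h y := by
  unfold transferOp
  rw [tsum_eq_single (⟨y, rfl⟩ : (T ⁻¹' {T y} : Set X))]
  · rw [← mul_assoc, ← Real.exp_add]; simp
  · rintro ⟨z, hz⟩ hne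
    have hzU : z ∉ U := fun hzU => hne (Subtype.ext (hinj hzU hy hz))
    simp [hh z hzU]

theorem transferOp_exp_neg_mul_eq_zero {X : Type*} {T : X → X} {φ h : X → ℝ} {U : Set X}
    (hh : ∀ y ∉ U, h y = 0) {x : X} (hx : x ∉ T '' U) :
    transferOp T φ (fun z => Real.exp (-φ z) * h z) x = 0 := by
  unfold transferOp
  convert tsum_zero with z
  have hzU : (z : X) ∉ U := fun hzU => hx ⟨z, hzU, z.2⟩
  simp [hh z hzU]

section GibbsEstimate

variable {X : Type*} [MetricSpace X]

/-- The open dynamical ball of radius `r` up to time `n`. -/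
def openDynBall (T : X → X) (x : X) (n : ℕ) (r : ℝ) : Set X :=
  {y | ∀ j < n, dist (T^[j] x) (T^[j] y) < r}

theorem isOpen_openDynBall {T : X → X} (hT : Continuous T) (x : X) (n : ℕ) (r : ℝ) :
    IsOpen (openDynBall T x n r) := by
  have h : openDynBall T x n r = ⋂ j ∈ Set.Iio n, {y | dist (T^[j] x) (T^[j] y) < r} := by
    ext y; simp [openDynBall]
  rw [h]
  exact (Set.finite_Iio n).isOpen_biInter fun j _ =>
    isOpen_lt (continuous_const.dist (hT.iterate j)) continuous_const

theorem mem_openDynBall_succ {T : X → X} {x y : X} {n : ℕ} {r : ℝ} :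
    y ∈ openDynBall T x (n + 1) r ↔ dist x y < r ∧ T y ∈ openDynBall T (T x) n r := by
  simp only [openDynBall, Set.mem_ofPred_eq, ← Function.iterate_succ_apply]
  constructor
  · exact fun h => ⟨h 0 n.succ_pos, fun j hj => h (j + 1) (Nat.succ_lt_succ hj)⟩
  · rintro ⟨h0, h1⟩ (_ | j) hj
    · exact h0
    · exact h1 j (Nat.lt_of_succ_lt_succ hj)

theorem injOn_ball_of_expanding {T : X → X} {L η : ℝ} (hL : 1 < L)
    (hexp : ∀ x y : X, dist x y < 2 * η → L * dist x y ≤ dist (T x) (T y)) (x : X) :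
    InjOn T (Metric.ball x η) := by
  intro y hy z hz hyz
  have h1 : dist y z < 2 * η := by
    have := dist_triangle_right y z x
    rw [Metric.mem_ball] at hy hz
    linarith
  have h2 := hexp y z h1
  rw [hyz, dist_self] at h2
  have h3 : 0 ≤ dist y z := dist_nonneg
  exact dist_le_zero.1 (by nlinarith)

/-- A continuous open map on a compact space is uniformly open. -/
theorem exists_ball_subset_image_ball [CompactSpace X] {T : X → X} (hcont : Continuous T)
    (hopen : IsOpenMap T) {η : ℝ} (hη : 0 < η) :
    ∃ s > 0, ∀ x, Metric.ball (T x) s ⊆ T '' Metric.ball x η := by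
  suffices h : ∃ s > 0, ∀ x ∈ (Set.univ : Set X), Metric.ball (T x) s ⊆ T '' Metric.ball x η by
    simpa using h
  refine isCompact_univ.induction_on (p := fun S => ∃ s > 0, ∀ x ∈ S,
    Metric.ball (T x) s ⊆ T '' Metric.ball x η) ⟨1, one_pos, by simp⟩ ?_ ?_ ?_
  · rintro S S' hS ⟨s, hs, h⟩
    exact ⟨s, hs, fun x hx => h x (hS hx)⟩
  · rintro S S' ⟨s, hs, h⟩ ⟨s', hs', h'⟩
    refine ⟨min s s', lt_min hs hs', fun x hx => ?_⟩
    rcases hx with hx | hx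
    · exact (Metric.ball_subset_ball (min_le_left _ _)).trans (h x hx)
    · exact (Metric.ball_subset_ball (min_le_right _ _)).trans (h' x hx)
  · intro x _
    obtain ⟨s, hs, h⟩ := Metric.isOpen_iff.1 (hopen _ (Metric.isOpen_ball (x := x) (ε := η / 2)))
      (T x) ⟨x, Metric.mem_ball_self (half_pos hη), rfl⟩
    refine ⟨Metric.ball x (η / 2) ∩ T ⁻¹' Metric.ball (T x) (s / 2), mem_nhdsWithin_of_mem_nhds
      (Filter.inter_mem (Metric.ball_mem_nhds x (half_pos hη))
        (hcont.continuousAt.preimage_mem_nhds (Metric.ball_mem_nhds _ (half_pos hs)))),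
      s / 2, half_pos hs, ?_⟩
    rintro z ⟨hz, hTz⟩
    have hTz' : dist (T z) (T x) < s / 2 := hTz
    have hz' : dist x z < η / 2 := by rw [dist_comm]; exact hz
    refine ((Metric.ball_subset_ball' (by linarith)).trans h).trans
      (Set.image_mono (Metric.ball_subset_ball' (by linarith)))

theorem ball_subset_image_ball_div {T : X → X} {L η ξ : ℝ} (hL : 1 < L)
    (hη : 0 < η) (hexp : ∀ x y : X, dist x y < 2 * η → L * dist x y ≤ dist (T x) (T y))
    (hξ : ∀ x, Metric.ball (T x) ξ ⊆ T '' Metric.ball x η) {r : ℝ} (hr : r ≤ ξ) (x : X) :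
    Metric.ball (T x) r ⊆ T '' Metric.ball x (r / L) := by
  intro y hy
  obtain ⟨z, hz, rfl⟩ := hξ x (Metric.ball_subset_ball hr hy)
  rw [Metric.mem_ball] at hy hz
  refine ⟨z, ?_, rfl⟩
  rw [Metric.mem_ball, lt_div_iff₀ (by linarith), mul_comm]
  exact (hexp z x (by linarith)).trans_lt hy

theorem ball_subset_image_iterate {T : X → X} {L η ξ : ℝ} (hL : 1 < L)
    (hη : 0 < η) (hexp : ∀ x y : X, dist x y < 2 * η → L * dist x y ≤ dist (T x) (T y))
    (hξ : ∀ x, Metric.ball (T x) ξ ⊆ T '' Metric.ball x η) (hξ0 : 0 < ξ) (n : ℕ) (x : X) :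
    Metric.ball (T^[n] x) ξ ⊆ T^[n] '' Metric.ball x (ξ / L ^ n) := by
  induction n generalizing x with
  | zero => simp
  | succ n ih =>
    rw [Function.iterate_succ, Set.image_comp]
    refine (ih (T x)).trans (Set.image_mono ?_)
    have h := ball_subset_image_ball_div hL hη hexp hξ
      (div_le_self hξ0.le (one_le_pow₀ hL.le (n := n))) x
    rwa [div_div, ← pow_succ] at h

theorem openDynBall_subset_image {T : X → X} {L η ξ : ℝ} (hL : 1 < L)
    (hη : 0 < η) (hexp : ∀ x y : X, dist x y < 2 * η → L * dist x y ≤ dist (T x) (T y))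
    (hξ : ∀ x, Metric.ball (T x) ξ ⊆ T '' Metric.ball x η) {r : ℝ} (hr0 : 0 < r) (hr : r ≤ ξ)
    (n : ℕ) (x : X) :
    openDynBall T (T x) (n + 1) r ⊆ T '' openDynBall T x (n + 2) r := by
  intro y hy
  have hy0 : dist (T x) y < r := (mem_openDynBall_succ.1 hy).1
  obtain ⟨z, hz, rfl⟩ := ball_subset_image_ball_div hL hη hexp hξ hr x
    (show y ∈ Metric.ball (T x) r by rwa [Metric.mem_ball, dist_comm])
  refine ⟨z, mem_openDynBall_succ.2 ⟨?_, hy⟩, rfl⟩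
  rw [dist_comm]
  exact hz.trans_le (div_le_self hr0.le hL.le)

/-- Every nonempty open set is swept over the whole space by a transitive open expanding map. -/
theorem iUnion_image_iterate_eq_univ [CompactSpace X]
    {T : X → X} (hcont : Continuous T) (hopen : IsOpenMap T) (hde : DistanceExpanding T)
    (htr : TopTransitive T) {U : Set X} (hU : IsOpen U) (hne : U.Nonempty) :
    ⋃ n : ℕ, T^[n] '' U = Set.univ := by
  obtain ⟨L, η, hL, hη, hexp⟩ := hde
  obtain ⟨ξ, hξ0, hξ⟩ := exists_ball_subset_image_ball hcont hopen hη
  obtain ⟨z, hz⟩ := hne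
  obtain ⟨r, hr, hrU⟩ := Metric.isOpen_iff.1 hU z hz
  obtain ⟨N, hN⟩ : ∃ N : ℕ, ξ / (r / 2) < L ^ N := pow_unbounded_of_one_lt _ hL
  refine Set.eq_univ_of_forall fun y => Set.mem_iUnion.2 ?_
  obtain ⟨n, w, ⟨v, ⟨x, hx, rfl⟩, rfl⟩, hw⟩ := htr (T^[N] '' Metric.ball z (r / 2))
    (Metric.ball y ξ) (hopen.iterate_self N _ Metric.isOpen_ball) Metric.isOpen_ball
    ⟨_, z, Metric.mem_ball_self (half_pos hr), rfl⟩ ⟨y, Metric.mem_ball_self hξ0⟩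
  rw [← Function.iterate_add_apply, Metric.mem_ball, dist_comm] at hw
  obtain ⟨u, hu, hy⟩ := ball_subset_image_iterate hL hη hexp hξ hξ0 (n + N) x hw
  refine ⟨n + N, u, hrU ?_, hy⟩
  have hLp : 0 < L ^ N := by positivity
  have hLL : L ^ N ≤ L ^ (n + N) := pow_le_pow_right₀ hL.le (Nat.le_add_left _ _)
  have h1 : ξ / L ^ (n + N) ≤ r / 2 := by
    rw [div_lt_iff₀ (half_pos hr)] at hN
    rw [div_le_iff₀ (by positivity)]
    nlinarith
  rw [Metric.mem_ball] at hu hx ⊢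
  linarith [dist_triangle u x z]

variable [MeasurableSpace X] [BorelSpace X]

theorem measurable_transferOp_exp_neg_mul {T : X → X} (hopen : IsOpenMap T) {φ h : X → ℝ}
    {U : Set X} (hinj : InjOn T U) (hh : ∀ y ∉ U, h y = 0) (hc : Continuous h)
    (h0 : ∀ y, 0 ≤ h y) :
    Measurable (transferOp T φ (fun z => Real.exp (-φ z) * h z)) := by
  refine measurable_of_Ioi fun t => ?_
  rcases lt_or_ge t 0 with ht | ht
  · convert MeasurableSet.univ
    refine Set.eq_univ_of_forall fun x => ht.trans_le ?_
    exact tsum_nonneg fun z => by have := h0 z; positivity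
  · convert (hopen _ (isOpen_lt continuous_const hc : IsOpen {y | t < h y})).measurableSet
    ext x
    constructor
    · intro hx
      by_cases hxU : x ∈ T '' U
      · obtain ⟨y, hy, rfl⟩ := hxU
        rw [Set.mem_preimage, transferOp_exp_neg_mul_apply hinj hh hy] at hx
        exact ⟨y, hx, rfl⟩
      · rw [Set.mem_preimage, transferOp_exp_neg_mul_eq_zero hh hxU] at hx
        exact absurd hx (not_lt.2 ht)
    · rintro ⟨y, hy, rfl⟩
      have hyU : y ∈ U := by
        by_contra hyU
        rw [Set.mem_ofPred_eq, hh y hyU] at hy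
        exact absurd hy (not_lt.2 ht)
      rw [Set.mem_preimage, transferOp_exp_neg_mul_apply hinj hh hyU]
      exact hy

/-- The Jacobian formula for conformal measures on open sets of injectivity. -/
theorem IsConformal.measureReal_image [CompactSpace X] {T : X → X} (hopen : IsOpenMap T)
    {φ : X → ℝ} (hφ : Continuous φ) {ν : Measure X} [IsFiniteMeasure ν] {lam : ℝ}
    (hν : IsConformal T φ ν lam) {U : Set X} (hU : IsOpen U) (hinj : InjOn T U) :
    ν.real (T '' U) = lam * ∫ x in U, Real.exp (-φ x) ∂ν := by
  have hF : IsClosed Uᶜ := hU.isClosed_compl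
  set h : ℕ → X → ℝ := fun k x => 1 - (hF.apprSeq k x : ℝ) with hdef
  have hc : ∀ k, Continuous (h k) := fun k =>
    continuous_const.sub (NNReal.continuous_coe.comp (hF.apprSeq k).continuous)
  have hh : ∀ k, ∀ y ∉ U, h k y = 0 := fun k y hy => by
    simp [hdef, HasOuterApproxClosed.apprSeq_apply_eq_one hF k (show y ∈ Uᶜ from hy)]
  have h0 : ∀ k y, 0 ≤ h k y := fun k y => by
    have : (hF.apprSeq k y : ℝ) ≤ 1 := by exact_mod_cast HasOuterApproxClosed.apprSeq_apply_le_one hF k y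
    simp only [hdef]; linarith
  have h1 : ∀ k y, h k y ≤ 1 := fun k y => by
    have : (0 : ℝ) ≤ hF.apprSeq k y := NNReal.coe_nonneg _
    simp only [hdef]; linarith
  have hlim : ∀ y ∈ U, Tendsto (fun k => h k y) atTop (𝓝 1) := fun y hy => by
    have h2 := tendsto_pi_nhds.1 (HasOuterApproxClosed.tendsto_apprSeq hF) y
    rw [Set.indicator_of_notMem (by simpa using hy)] at h2
    simpa [hdef] using (NNReal.tendsto_coe.2 h2).const_sub 1
  have hconf : ∀ k, ∫ x, transferOp T φ (fun z => Real.exp (-φ z) * h k z) x ∂ν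
      = lam * ∫ x, Real.exp (-φ x) * h k x ∂ν := fun k =>
    hν.2 ⟨fun z => Real.exp (-φ z) * h k z, (Real.continuous_exp.comp hφ.neg).mul (hc k)⟩
  have hL : Tendsto (fun k => ∫ x, transferOp T φ (fun z => Real.exp (-φ z) * h k z) x ∂ν) atTop
      (𝓝 (∫ x, (T '' U).indicator (fun _ => (1 : ℝ)) x ∂ν)) := by
    refine tendsto_integral_of_dominated_convergence (fun _ => 1)
      (fun k => (measurable_transferOp_exp_neg_mul hopen hinj (hh k) (hc k)
        (h0 k)).aestronglyMeasurable) (integrable_const _) (fun k => ae_of_all _ fun x => ?_)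
      (ae_of_all _ fun x => ?_)
    · by_cases hx : x ∈ T '' U
      · obtain ⟨y, hy, rfl⟩ := hx
        rw [transferOp_exp_neg_mul_apply hinj (hh k) hy, Real.norm_of_nonneg (h0 k y)]
        exact h1 k y
      · rw [transferOp_exp_neg_mul_eq_zero (hh k) hx]; simp
    · by_cases hx : x ∈ T '' U
      · rw [Set.indicator_of_mem hx]
        obtain ⟨y, hy, rfl⟩ := hx
        simpa only [transferOp_exp_neg_mul_apply hinj (hh _) hy] using hlim y hy
      · rw [Set.indicator_of_notMem hx]
        simp only [transferOp_exp_neg_mul_eq_zero (hh _) hx, tendsto_const_nhds]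
  have hR : Tendsto (fun k => ∫ x, Real.exp (-φ x) * h k x ∂ν) atTop
      (𝓝 (∫ x, U.indicator (fun x => Real.exp (-φ x)) x ∂ν)) := by
    have hec : Continuous fun x => Real.exp (-φ x) := Real.continuous_exp.comp hφ.neg
    refine tendsto_integral_of_dominated_convergence (fun x => Real.exp (-φ x))
      (fun k => (hec.mul (hc k)).measurable.aestronglyMeasurable)
      (hec.integrable_of_hasCompactSupport (HasCompactSupport.of_compactSpace _))
      (fun k => ae_of_all _ fun x => ?_) (ae_of_all _ fun x => ?_)
    · rw [Real.norm_of_nonneg (mul_nonneg (Real.exp_pos _).le (h0 k x))]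
      exact mul_le_of_le_one_right (Real.exp_pos _).le (h1 k x)
    · by_cases hx : x ∈ U
      · rw [Set.indicator_of_mem hx]
        simpa using (hlim x hx).const_mul (Real.exp (-φ x))
      · rw [Set.indicator_of_notMem hx]
        simp [hh _ x hx]
  rw [integral_indicator_const _ (hopen U hU).measurableSet] at hL
  rw [integral_indicator hU.measurableSet] at hR
  simp only [hconf] at hL
  simpa using tendsto_nhds_unique hL (hR.const_mul lam)

theorem IsConformal.measureReal_image_bounds [CompactSpace X] {T : X → X} (hopen : IsOpenMap T)
    {φ : X → ℝ} (hφ : Continuous φ) {ν : Measure X} [IsFiniteMeasure ν] {lam : ℝ}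
    (hν : IsConformal T φ ν lam) {U : Set X} (hU : IsOpen U) (hinj : InjOn T U) {a δ : ℝ}
    (hosc : ∀ y ∈ U, |φ y - a| ≤ δ) :
    lam * (Real.exp (-a - δ) * ν.real U) ≤ ν.real (T '' U) ∧
      ν.real (T '' U) ≤ lam * (Real.exp (-a + δ) * ν.real U) := by
  have hint : Integrable (fun x => Real.exp (-φ x)) ν :=
    (Real.continuous_exp.comp hφ.neg).integrable_of_hasCompactSupport
      (HasCompactSupport.of_compactSpace _)
  rw [hν.measureReal_image hopen hφ hU hinj]
  constructor
  · refine mul_le_mul_of_nonneg_left ?_ hν.1.le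
    rw [mul_comm, ← smul_eq_mul, ← setIntegral_const]
    refine setIntegral_mono_on integrableOn_const hint.integrableOn hU.measurableSet
      fun y hy => Real.exp_le_exp.2 ?_
    linarith [abs_le.1 (hosc y hy)]
  · refine mul_le_mul_of_nonneg_left ?_ hν.1.le
    rw [mul_comm (Real.exp _), ← smul_eq_mul, ← setIntegral_const]
    refine setIntegral_mono_on hint.integrableOn integrableOn_const hU.measurableSet
      fun y hy => Real.exp_le_exp.2 ?_
    linarith [abs_le.1 (hosc y hy)]

theorem IsConformal.measure_image_eq_zero [CompactSpace X] {T : X → X} (hopen : IsOpenMap T)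
    (hde : DistanceExpanding T) {φ : X → ℝ} (hφ : Continuous φ) {ν : Measure X}
    [IsFiniteMeasure ν] {lam : ℝ} (hν : IsConformal T φ ν lam) {U : Set X} (hU : IsOpen U)
    (h0 : ν U = 0) : ν (T '' U) = 0 := by
  obtain ⟨L, η, hL, hη, hexp⟩ := hde
  obtain ⟨t, -, htf, hcov⟩ := (isCompact_univ (X := X)).finite_cover_balls hη
  have hsub : T '' U ⊆ ⋃ x ∈ t, T '' (U ∩ Metric.ball x η) := by
    rintro _ ⟨y, hy, rfl⟩
    obtain ⟨x, hx, hyx⟩ := Set.mem_iUnion₂.1 (hcov (Set.mem_univ y))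
    exact Set.mem_iUnion₂.2 ⟨x, hx, y, ⟨hy, hyx⟩, rfl⟩
  refine measure_mono_null hsub ((measure_biUnion_null_iff htf.countable).2 fun x _ => ?_)
  have h1 := hν.measureReal_image hopen hφ (hU.inter (Metric.isOpen_ball (x := x) (ε := η)))
    ((injOn_ball_of_expanding hL hexp x).mono Set.inter_subset_right)
  rw [Measure.restrict_eq_zero.2 (measure_mono_null Set.inter_subset_left h0),
    integral_zero_measure, mul_zero, measureReal_eq_zero_iff] at h1
  exact h1

theorem IsConformal.measure_pos [CompactSpace X] {T : X → X} (hcont : Continuous T)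
    (hopen : IsOpenMap T) (hde : DistanceExpanding T) (htr : TopTransitive T) {φ : X → ℝ}
    (hφ : Continuous φ) {ν : Measure X} [IsProbabilityMeasure ν] {lam : ℝ}
    (hν : IsConformal T φ ν lam) {U : Set X} (hU : IsOpen U) (hne : U.Nonempty) : 0 < ν U := by
  refine pos_iff_ne_zero.2 fun h0 => ?_
  have hn : ∀ n : ℕ, ν (T^[n] '' U) = 0 := by
    intro n
    induction n with
    | zero => simpa using h0
    | succ n ih =>
      rw [Function.iterate_succ', Set.image_comp]
      exact hν.measure_image_eq_zero hopen hde hφ (hopen.iterate_self n _ hU) ih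
  have h1 := measure_iUnion_null hn
  rw [iUnion_image_iterate_eq_univ hcont hopen hde htr hU hne, measure_univ] at h1
  exact one_ne_zero h1

theorem IsConformal.exists_le_measureReal_ball [CompactSpace X] {T : X → X}
    (hcont : Continuous T) (hopen : IsOpenMap T) (hde : DistanceExpanding T)
    (htr : TopTransitive T) {φ : X → ℝ} (hφ : Continuous φ) {ν : Measure X}
    [IsProbabilityMeasure ν] {lam : ℝ} (hν : IsConformal T φ ν lam) {r : ℝ} (hr : 0 < r) :
    ∃ c > 0, ∀ x, c ≤ ν.real (Metric.ball x r) := by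
  suffices h : ∃ c > 0, ∀ x ∈ (Set.univ : Set X), c ≤ ν.real (Metric.ball x r) by simpa using h
  refine isCompact_univ.induction_on (p := fun S => ∃ c > 0, ∀ x ∈ S,
    c ≤ ν.real (Metric.ball x r)) ⟨1, one_pos, by simp⟩ ?_ ?_ ?_
  · rintro S S' hS ⟨c, hc, h⟩
    exact ⟨c, hc, fun x hx => h x (hS hx)⟩
  · rintro S S' ⟨c, hc, h⟩ ⟨c', hc', h'⟩
    refine ⟨min c c', lt_min hc hc', fun x hx => ?_⟩
    rcases hx with hx | hx
    · exact (min_le_left _ _).trans (h x hx)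
    · exact (min_le_right _ _).trans (h' x hx)
  · intro x _
    refine ⟨Metric.ball x (r / 2), mem_nhdsWithin_of_mem_nhds
      (Metric.ball_mem_nhds x (half_pos hr)), ν.real (Metric.ball x (r / 2)), ?_, ?_⟩
    · exact ENNReal.toReal_pos_iff.2 ⟨hν.measure_pos hcont hopen hde htr hφ Metric.isOpen_ball
        ⟨x, Metric.mem_ball_self (half_pos hr)⟩, measure_lt_top _ _⟩
    · intro z hz
      refine measureReal_mono (Metric.ball_subset_ball' ?_)
      rw [Metric.mem_ball, dist_comm] at hz
      linarith

end GibbsEstimate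

/-- **Proposition (Gibbs property of conformal measures).** If `ν` is `φ`-conformal with
eigenvalue `lam` and `P = log lam`, then for any `δ > 0` and all small enough `ε > 0` there
is `α(ε) > 0` with
`α(ε) e^{-nδ} ≤ ν(B(x,n,ε)) / exp(S_n φ(x) - P n) ≤ e^{nδ}` for all `x` and `n ≥ 1`. -/
theorem conformal_measure_gibbs_estimate
    {X : Type*} [MetricSpace X] [CompactSpace X] [MeasurableSpace X] [BorelSpace X]
    (T : X → X) (hcont : Continuous T) (hopen : IsOpenMap T)
    (hde : DistanceExpanding T) (htr : TopTransitive T)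
    (φ : X → ℝ) (hφ : Continuous φ)
    (ν : ProbabilityMeasure X) (lam : ℝ) (hν : IsConformal T φ (ν : Measure X) lam)
    (δ : ℝ) (hδ : 0 < δ) :
    ∃ ε₀ : ℝ, 0 < ε₀ ∧ ∀ ε : ℝ, 0 < ε → ε < ε₀ → ∃ α : ℝ, 0 < α ∧
      ∀ (x : X) (n : ℕ), 1 ≤ n →
        ENNReal.ofReal (α * Real.exp (-(n : ℝ) * δ) *
            Real.exp (birkhoff T φ n x - Real.log lam * n))
          ≤ (ν : Measure X) (dynBall T x n ε) ∧
        (ν : Measure X) (dynBall T x n ε)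
          ≤ ENNReal.ofReal (Real.exp ((n : ℝ) * δ) *
              Real.exp (birkhoff T φ n x - Real.log lam * n)) := by
  have hosc : ∃ ρ > 0, ∀ x y : X, dist x y < ρ → |φ y - φ x| ≤ δ := by
    obtain ⟨ρ, hρ, h⟩ := Metric.uniformContinuous_iff.1
      (CompactSpace.uniformContinuous_of_continuous hφ) δ hδ
    exact ⟨ρ, hρ, fun x y hxy => by rw [abs_sub_comm]; exact (h hxy).le⟩
  obtain ⟨ρ, hρ, hosc⟩ := hosc
  obtain ⟨L, η, hL, hη, hexp⟩ := id hde
  obtain ⟨ξ, hξ0, hξ⟩ := exists_ball_subset_image_ball hcont hopen hη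
  have hbounds : ∀ r : ℝ, r ≤ η → r ≤ ρ → ∀ (x : X) (n : ℕ),
      lam * (Real.exp (-φ x - δ) * (ν : Measure X).real (openDynBall T x (n + 1) r)) ≤
          (ν : Measure X).real (T '' openDynBall T x (n + 1) r) ∧
        (ν : Measure X).real (T '' openDynBall T x (n + 1) r) ≤
          lam * (Real.exp (-φ x + δ) * (ν : Measure X).real (openDynBall T x (n + 1) r)) := by
    intro r hrη hrρ x n
    have hd : ∀ y ∈ openDynBall T x (n + 1) r, dist x y < r :=
      fun y hy => (mem_openDynBall_succ.1 hy).1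
    refine hν.measureReal_image_bounds hopen hφ (isOpen_openDynBall hcont x _ r) ?_
      fun y hy => hosc x y ((hd y hy).trans_le hrρ)
    refine (injOn_ball_of_expanding hL hexp x).mono fun y hy => ?_
    rw [Metric.mem_ball, dist_comm]
    exact (hd y hy).trans_le hrη
  have hlam : Real.exp (Real.log lam) = lam := Real.exp_log hν.1
  have hupper : ∀ r : ℝ, r ≤ η → r ≤ ρ → ∀ (n : ℕ) (x : X),
      (ν : Measure X).real (openDynBall T x n r) ≤
        Real.exp (n * δ) * Real.exp (birkhoff T φ n x - Real.log lam * n) := by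
    intro r hrη hrρ n
    induction n with
    | zero => intro x; simp [birkhoff]
    | succ n ih =>
      intro x
      have h1 := (hbounds r hrη hrρ x n).1
      have h2 : (ν : Measure X).real (T '' openDynBall T x (n + 1) r) ≤
          (ν : Measure X).real (openDynBall T (T x) n r) := by
        refine measureReal_mono ?_
        rintro _ ⟨y, hy, rfl⟩
        exact (mem_openDynBall_succ.1 hy).2
      have h3 := h1.trans (h2.trans (ih (T x)))
      nth_rewrite 1 [← hlam] at h3
      rw [← mul_assoc, ← Real.exp_add, ← Real.exp_add, ← le_div_iff₀' (Real.exp_pos _),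
        ← Real.exp_sub] at h3
      refine h3.trans_eq ?_
      rw [birkhoff_succ, ← Real.exp_add]
      congr 1
      push_cast
      ring
  refine ⟨min η ρ / 2, by positivity, fun ε hε hε₀ => ?_⟩
  have hεη : 2 * ε ≤ η := by linarith [min_le_left η ρ]
  have hερ : 2 * ε ≤ ρ := by linarith [min_le_right η ρ]
  set r := min ε ξ
  have hr0 : 0 < r := lt_min hε hξ0
  have hrε : r ≤ ε := min_le_left _ _
  obtain ⟨c, hc, hball⟩ := hν.exists_le_measureReal_ball hcont hopen hde htr hφ hr0
  have hlower : ∀ (n : ℕ) (x : X),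
      c * Real.exp (-(n : ℝ) * δ) * Real.exp (birkhoff T φ n x - Real.log lam * n) ≤
        (ν : Measure X).real (openDynBall T x (n + 1) r) := by
    intro n
    induction n with
    | zero =>
      intro x
      have h : openDynBall T x (0 + 1) r = Metric.ball x r := by
        ext y; simp [openDynBall, dist_comm]
      rw [h]
      simpa [birkhoff] using hball x
    | succ n ih =>
      intro x
      have h1 := (hbounds r (by linarith) (by linarith) x (n + 1)).2
      have h2 := (ih (T x)).trans (measureReal_mono
        (openDynBall_subset_image hL hη hexp hξ hr0 (min_le_right _ _) n x))
      have h3 := h2.trans h1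
      nth_rewrite 2 [← hlam] at h3
      rw [← mul_assoc, ← Real.exp_add, ← div_le_iff₀' (Real.exp_pos _), mul_assoc, mul_div_assoc,
        ← Real.exp_add, ← Real.exp_sub] at h3
      refine Eq.trans_le ?_ h3
      rw [birkhoff_succ, mul_assoc, ← Real.exp_add]
      congr 2
      push_cast
      ring
  refine ⟨c, hc, fun x n _ => ⟨?_, ?_⟩⟩
  · rw [← ofReal_measureReal]
    refine ENNReal.ofReal_le_ofReal ((hlower n x).trans (measureReal_mono fun y hy j hj => ?_))
    exact (hy j (hj.trans n.lt_succ_self)).le.trans hrε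
  · rw [← ofReal_measureReal]
    have hsub : dynBall T x n ε ⊆ openDynBall T x n (2 * ε) :=
      fun y hy j hj => (hy j hj).trans_lt (by linarith)
    exact ENNReal.ofReal_le_ofReal ((measureReal_mono hsub).trans (hupper (2 * ε) hεη hερ n x))
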